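/- Along the unperturbed homoclinic solution, the second Melnikov function satisfies M₁(τ₀, θ₀) = M₂(τ₀, θ₀) = sin(2(ωτ₀ + θ̃₀)) · π e^{−2ω√(2|h|)}/√(2|h|), where θ̃₀ = −θ₀ − ωτ₀; consequently M₁ and M₂ have simple zeros exactly at θ₀ = ±kπ/2, k = 0, 1, 2, …, i.e. sin(2(ωτ₀ + θ̃₀)) = −sin(2θ₀) vanishes with nonzero derivative in θ₀ there. -/

import Mathlib

open Real Filter intervalIntegral

open MeasureTheory FourierTransform in
theorem aux_int (a : ℝ) (ha : 0 < a) :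
    Integrable (fun s : ℝ => 1 / (a ^ 2 + s ^ 2)) := by
  have h1 := (integrable_inv_one_add_sq.comp_mul_left' (inv_ne_zero ha.ne')).const_mul (1 / a ^ 2)
  refine h1.congr (Eventually.of_forall fun s => ?_)
  have h2 : a ^ 2 + s ^ 2 ≠ 0 := by positivity
  have h3 : 1 + (a⁻¹ * s) ^ 2 ≠ 0 := by positivity
  have h4 : a ^ 2 * (1 + (a⁻¹ * s) ^ 2) = a ^ 2 + s ^ 2 := by field_simp
  simp only
  rw [← h4, one_div, one_div, mul_inv]

open MeasureTheory FourierTransform in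
theorem aux_split (A : ℝ) (hA : 0 < A) (w : ℝ) :
    Integrable (fun v : ℝ => Complex.exp (((-2 * π * v * w : ℝ) : ℂ) * Complex.I) •
      ((Real.exp (-A * |v|) : ℝ) : ℂ)) ∧
    ∫ v : ℝ, Complex.exp (((-2 * π * v * w : ℝ) : ℂ) * Complex.I) •
      ((Real.exp (-A * |v|) : ℝ) : ℂ) = ((2 * A / (A ^ 2 + (2 * π * w) ^ 2) : ℝ) : ℂ) := by
  set z₁ : ℂ := -A - 2 * π * w * Complex.I with hz₁
  set z₂ : ℂ := A - 2 * π * w * Complex.I with hz₂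
  have r₁ : z₁.re < 0 := by simp [hz₁, hA]
  have r₂ : 0 < z₂.re := by simp [hz₂, hA]
  have i₁ := integrableOn_exp_mul_complex_Ioi r₁ 0
  have i₂ := integrableOn_exp_mul_complex_Iic r₂ 0
  have e₁ : Set.EqOn (fun v : ℝ => Complex.exp (z₁ * v)) (fun v : ℝ =>
      Complex.exp (((-2 * π * v * w : ℝ) : ℂ) * Complex.I) •
      ((Real.exp (-A * |v|) : ℝ) : ℂ)) (Set.Ioi 0) := by
    intro v hv
    simp only [smul_eq_mul, abs_of_pos (Set.mem_Ioi.1 hv)]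
    rw [Complex.ofReal_exp, ← Complex.exp_add, hz₁]
    congr 1
    push_cast
    ring
  have e₂ : Set.EqOn (fun v : ℝ => Complex.exp (z₂ * v)) (fun v : ℝ =>
      Complex.exp (((-2 * π * v * w : ℝ) : ℂ) * Complex.I) •
      ((Real.exp (-A * |v|) : ℝ) : ℂ)) (Set.Iic 0) := by
    intro v hv
    simp only [smul_eq_mul, abs_of_nonpos (Set.mem_Iic.1 hv)]
    rw [Complex.ofReal_exp, ← Complex.exp_add, hz₂]
    congr 1
    push_cast
    ring
  have j₁ := i₁.congr_fun e₁ measurableSet_Ioi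
  have j₂ := i₂.congr_fun e₂ measurableSet_Iic
  refine ⟨?_, ?_⟩
  · rw [← integrableOn_univ, ← Set.Iic_union_Ioi (a := (0 : ℝ))]
    exact j₂.union j₁
  · rw [← intervalIntegral.integral_Iic_add_Ioi j₂ j₁,
      ← setIntegral_congr_fun measurableSet_Ioi e₁, ← setIntegral_congr_fun measurableSet_Iic e₂,
      integral_exp_mul_complex_Ioi r₁, integral_exp_mul_complex_Iic r₂]
    have n₁ : z₁ ≠ 0 := by intro h; simp [h] at r₁
    have n₂ : z₂ ≠ 0 := by intro h; simp [h] at r₂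
    have n₃ : (A ^ 2 + (2 * π * w) ^ 2 : ℂ) ≠ 0 := by
      have : A ^ 2 + (2 * π * w) ^ 2 ≠ 0 := by positivity
      exact_mod_cast this
    push_cast
    simp only [mul_zero, Complex.exp_zero]
    rw [div_add_div _ _ n₂ n₁, div_eq_div_iff (mul_ne_zero n₂ n₁) n₃, hz₁, hz₂]
    ring_nf
    simp only [Complex.I_sq]
    ring

open MeasureTheory FourierTransform in
theorem aux_fourier (a : ℝ) (ha : 0 < a) (k : ℝ) (hk : 0 ≤ k) :
    ∫ s : ℝ, Complex.exp ((k * s : ℝ) * Complex.I) * ((1 / (a ^ 2 + s ^ 2) : ℝ) : ℂ)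
      = ((π / a * Real.exp (-k * a) : ℝ) : ℂ) := by
  have hA : 0 < 2 * π * a := by positivity
  set f : ℝ → ℂ := fun v => ((Real.exp (-(2 * π * a) * |v|) : ℝ) : ℂ) with hf
  have hF : 𝓕 f = fun w : ℝ => ((a / π : ℝ) : ℂ) * ((1 / (a ^ 2 + w ^ 2) : ℝ) : ℂ) := by
    ext w
    rw [Real.fourier_real_eq_integral_exp_smul, (aux_split _ hA w).2, ← Complex.ofReal_mul]
    congr 1
    have : a ^ 2 + w ^ 2 ≠ 0 := by positivity
    have h2 : (2 * π * a) ^ 2 + (2 * π * w) ^ 2 = (2 * π) ^ 2 * (a ^ 2 + w ^ 2) := by ring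
    rw [h2]
    field_simp
  have hc : Continuous f := by fun_prop
  have hi : Integrable f := by simpa [hf] using (aux_split _ hA 0).1
  have hFi : Integrable (𝓕 f) := by
    rw [hF]
    exact (aux_int a ha).ofReal.const_mul _
  have key := congrFun (hc.fourierInv_fourier_eq hi hFi) (k / (2 * π))
  rw [Real.fourierInv_eq', hF, hf] at key
  have e : ∀ v : ℝ, Complex.exp (((2 * π * inner ℝ v (k / (2 * π)) : ℝ) : ℂ) * Complex.I) •
      (((a / π : ℝ) : ℂ) * ((1 / (a ^ 2 + v ^ 2) : ℝ) : ℂ)) = ((a / π : ℝ) : ℂ) *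
      (Complex.exp ((k * v : ℝ) * Complex.I) * ((1 / (a ^ 2 + v ^ 2) : ℝ) : ℂ)) := by
    intro v
    have : 2 * π * inner ℝ v (k / (2 * π)) = k * v := by
      simp
      field_simp
    rw [this, smul_eq_mul]
    ring
  simp_rw [e] at key
  rw [MeasureTheory.integral_const_mul] at key
  have hne : ((a / π : ℝ) : ℂ) ≠ 0 := by
    have : a / π ≠ 0 := by positivity
    exact_mod_cast this
  apply mul_left_cancel₀ hne
  rw [key, ← Complex.ofReal_mul]
  congr 1
  rw [abs_of_nonneg (by positivity)]
  have : -(2 * π * a) * (k / (2 * π)) = -k * a := by field_simp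
  rw [this]
  field_simp

open MeasureTheory in
theorem aux_real (a : ℝ) (ha : 0 < a) (k : ℝ) (hk : 0 ≤ k) (c : ℝ) :
    Integrable (fun s : ℝ => 2 / (a ^ 2 + s ^ 2) * Real.sin (k * s - c)) ∧
    ∫ s : ℝ, 2 / (a ^ 2 + s ^ 2) * Real.sin (k * s - c)
      = -Real.sin c * (2 * (π / a * Real.exp (-k * a))) := by
  have hi : Integrable (fun s : ℝ => Complex.exp ((k * s : ℝ) * Complex.I) *
      ((1 / (a ^ 2 + s ^ 2) : ℝ) : ℂ)) := by
    refine (aux_int a ha).ofReal.bdd_mul (c := 1) (by fun_prop) ?_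
    exact Eventually.of_forall fun s => by rw [Complex.norm_exp_ofReal_mul_I]
  have hi2 := hi.const_mul (2 * Complex.exp ((-c : ℝ) * Complex.I))
  have e : ∀ s : ℝ, RCLike.im (2 * Complex.exp ((-c : ℝ) * Complex.I) *
      (Complex.exp ((k * s : ℝ) * Complex.I) * ((1 / (a ^ 2 + s ^ 2) : ℝ) : ℂ))) =
      2 / (a ^ 2 + s ^ 2) * Real.sin (k * s - c) := by
    intro s
    have : 2 * Complex.exp ((-c : ℝ) * Complex.I) *
      (Complex.exp ((k * s : ℝ) * Complex.I) * ((1 / (a ^ 2 + s ^ 2) : ℝ) : ℂ)) =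
      ((2 / (a ^ 2 + s ^ 2) : ℝ) : ℂ) * Complex.exp ((k * s - c : ℝ) * Complex.I) := by
      have h1 : Complex.exp ((k * s - c : ℝ) * Complex.I) =
        Complex.exp ((-c : ℝ) * Complex.I) * Complex.exp ((k * s : ℝ) * Complex.I) := by
        rw [← Complex.exp_add]
        congr 1
        push_cast
        ring
      rw [h1]
      push_cast
      ring
    rw [this]
    change Complex.im _ = _
    rw [Complex.im_ofReal_mul, Complex.exp_ofReal_mul_I_im]
  refine ⟨?_, ?_⟩
  · exact hi2.im.congr (Eventually.of_forall e)
  · have h1 := integral_im hi2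
    simp_rw [e] at h1
    rw [h1, MeasureTheory.integral_const_mul, aux_fourier a ha k hk]
    change Complex.im _ = _
    rw [mul_assoc, mul_comm (Complex.exp _), ← mul_assoc]
    have : (2 : ℂ) * ((π / a * Real.exp (-k * a) : ℝ) : ℂ) =
      ((2 * (π / a * Real.exp (-k * a)) : ℝ) : ℂ) := by push_cast; ring
    rw [this, Complex.im_ofReal_mul, Complex.exp_ofReal_mul_I_im, Real.sin_neg]
    ring

theorem aux_period (ω : ℝ) (hω : 0 < ω) (d : ℝ) (N : ℕ) :
    ∫ τ in (-(N * π / (2 * ω)))..(N * π / (2 * ω)), Real.sin (2 * ω * τ + d) = 0 := by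
  rw [intervalIntegral.integral_comp_mul_add (fun x => Real.sin x) (by positivity : 2 * ω ≠ 0)]
  have h1 : 2 * ω * -(N * π / (2 * ω)) + d = d - N * π := by field_simp; ring
  have h2 : 2 * ω * (N * π / (2 * ω)) + d = d + N * π := by field_simp; ring
  rw [h1, h2, integral_sin, Real.cos_sub_nat_mul_pi, Real.cos_add_nat_mul_pi]
  simp

theorem stmt16 (h b τ₀ θ₀ : ℝ) (hh : h < 0) (hb : 0 < b) :
    let ω := Real.sqrt (2 * b)
    let C := π * Real.exp (-2 * ω * Real.sqrt (2 * |h|)) / Real.sqrt (2 * |h|)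
    let θt := -θ₀ - ω * τ₀
    let R : ℝ → ℝ := fun s => 2 / (2 * |h| + s ^ 2)
    Tendsto (fun N : ℕ =>
        (1 / 2) * ∫ τ in (-(N * π / (2 * ω)))..(N * π / (2 * ω)),
          (R (τ - τ₀) + 2 * b) * Real.sin (2 * (ω * (τ - τ₀) - θ₀)))
      atTop (nhds (Real.sin (2 * (ω * τ₀ + θt)) * C)) ∧
    Real.sin (2 * (ω * τ₀ + θt)) =
      Real.cos (2 * θt) * Real.sin (2 * ω * τ₀) +
        Real.sin (2 * θt) * Real.cos (2 * ω * τ₀) ∧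
    Real.sin (2 * (ω * τ₀ + θt)) = -Real.sin (2 * θ₀) ∧
    (Real.sin (2 * (ω * τ₀ + θt)) * C = 0 ↔ ∃ k : ℤ, θ₀ = k * π / 2) ∧
    (∀ k : ℤ, deriv (fun θ : ℝ => -Real.sin (2 * θ) * C) ((k : ℝ) * π / 2) ≠ 0) := by
  intro ω C θt R
  have hω : 0 < ω := Real.sqrt_pos.2 (by positivity)
  have hh' : 0 < 2 * |h| := by have := abs_pos.2 hh.ne; positivity
  set a := Real.sqrt (2 * |h|) with ha'
  have ha : 0 < a := Real.sqrt_pos.2 hh'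
  have hasq : a ^ 2 = 2 * |h| := Real.sq_sqrt hh'.le
  have hC : 0 < C := by positivity
  have hs : Real.sin (2 * (ω * τ₀ + θt)) = -Real.sin (2 * θ₀) := by
    rw [← Real.sin_neg]
    congr 1
    simp only [θt]
    ring
  refine ⟨?_, ?_, hs, ?_, ?_⟩
  · obtain ⟨hi, hv⟩ := aux_real a ha (2 * ω) (by positivity) (2 * θ₀)
    have hi' := hi.comp_sub_right τ₀
    have hv' := (MeasureTheory.integral_sub_right_eq_self (μ := MeasureTheory.volume)
      (fun s : ℝ => 2 / (a ^ 2 + s ^ 2) * Real.sin (2 * ω * s - 2 * θ₀)) τ₀).trans hv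
    have ht : Tendsto (fun N : ℕ => N * π / (2 * ω)) atTop atTop := by
      have : (fun N : ℕ => N * π / (2 * ω)) = fun N : ℕ => (N : ℝ) * (π / (2 * ω)) := by
        ext N; ring
      rw [this]
      exact tendsto_natCast_atTop_atTop.atTop_mul_const (by positivity)
    have hl := (MeasureTheory.intervalIntegral_tendsto_integral hi'
      (tendsto_neg_atTop_atBot.comp ht) ht).const_mul (1 / 2)
    rw [hv'] at hl
    have hlim : Real.sin (2 * (ω * τ₀ + θt)) * C =
        1 / 2 * (-Real.sin (2 * θ₀) * (2 * (π / a * Real.exp (-(2 * ω) * a)))) := by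
      rw [hs]
      simp only [C, neg_mul]
      ring
    rw [hlim]
    refine hl.congr fun N => ?_
    congr 1
    simp only [Function.comp]
    have e : ∀ τ : ℝ, (R (τ - τ₀) + 2 * b) * Real.sin (2 * (ω * (τ - τ₀) - θ₀)) =
        2 / (a ^ 2 + (τ - τ₀) ^ 2) * Real.sin (2 * ω * (τ - τ₀) - 2 * θ₀) +
        2 * b * Real.sin (2 * ω * τ + (-2 * ω * τ₀ - 2 * θ₀)) := by
      intro τ
      have h1 : 2 * (ω * (τ - τ₀) - θ₀) = 2 * ω * (τ - τ₀) - 2 * θ₀ := by ring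
      have h2 : 2 * ω * τ + (-2 * ω * τ₀ - 2 * θ₀) = 2 * ω * (τ - τ₀) - 2 * θ₀ := by ring
      rw [h1, h2, hasq]
      ring
    simp_rw [e]
    rw [intervalIntegral.integral_add hi'.intervalIntegrable
      (Continuous.intervalIntegrable (by fun_prop) _ _),
      intervalIntegral.integral_const_mul, aux_period ω hω]
    simp
  · rw [mul_add, Real.sin_add, ← mul_assoc]
    ring
  · rw [hs, mul_eq_zero, or_iff_left hC.ne', neg_eq_zero, Real.sin_eq_zero_iff]
    constructor
    · rintro ⟨k, hk⟩
      exact ⟨k, by linarith⟩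
    · rintro ⟨k, hk⟩
      exact ⟨k, by linarith⟩
  · intro k
    have hd : HasDerivAt (fun θ : ℝ => -Real.sin (2 * θ) * C)
        (-(Real.cos (2 * (k * π / 2)) * (2 * 1)) * C) (k * π / 2) :=
      ((((hasDerivAt_id' _).const_mul 2).sin).neg).mul_const C
    rw [hd.deriv]
    have : 2 * (k * π / 2) = k * π := by ring
    rw [this]
    have hcos : Real.cos (k * π) ≠ 0 := by
      intro h0
      have h1 := Real.sin_sq_add_cos_sq (k * π)
      rw [h0, Real.sin_int_mul_pi] at h1
      norm_num at h1
    have := hC.ne'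
    simp [hcos, this]
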